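/- The function h(p) = g(p)/p² is differentiable on (0, ∞) with { p > 0 : h'(p) = 0 } = {1, 18} (so the free-boundary problem has exactly the two solutions (U₁(x) = x², p* = 1) and (U₂(x) = (34/9)x², p* = 18)). Moreover, h has a strict local minimum at p = 1; consequently, for every x ∈ (0, 1), the function p ↦ V_p(x) has a strict local minimum at p = 1, so the free-boundary solution (U₁, 1) is not a solution of the optimal stopping problem even over threshold stopping times. -/

import Mathlib

open Set Filter

/-- Example 2 payoff: `g(x) = ((x−1)² + 1)·x²` for `x ≤ 2` and
`g(x) = x − 9 + (15/4)·x²` for `x > 2`. -/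
noncomputable def gEx (x : ℝ) : ℝ :=
  if x ≤ 2 then ((x - 1) ^ 2 + 1) * x ^ 2 else x - 9 + (15 / 4) * x ^ 2

/-- Example 2: `h(p) = g(p)/p²` (here `ψ(x) = x²`). -/
noncomputable def hEx (p : ℝ) : ℝ := gEx p / p ^ 2

/-- Example 2 threshold value: `V_p(x) = h(p)·x²` for `x < p`, `g(x)` for `x ≥ p`. -/
noncomputable def VEx (p x : ℝ) : ℝ :=
  if x < p then hEx p * x ^ 2 else gEx x

theorem hEx_of_le_two {p : ℝ} (hp : 0 < p) (h : p ≤ 2) : hEx p = (p - 1) ^ 2 + 1 := by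
  simp only [hEx, gEx, if_pos h]
  field_simp

theorem hEx_of_two_le {p : ℝ} (h : 2 ≤ p) : hEx p = (p - 9) / p ^ 2 + 15 / 4 := by
  rcases h.eq_or_lt with rfl | h
  · norm_num [hEx, gEx]
  · have hp : p ≠ 0 := by linarith
    simp only [hEx, gEx, if_neg h.not_ge]
    field_simp

theorem hasDerivAt_left_branch (p : ℝ) :
    HasDerivAt (fun q : ℝ => (q - 1) ^ 2 + 1) (2 * (p - 1)) p := by
  simpa using (((hasDerivAt_id p).sub_const 1).pow 2).add_const 1

theorem hasDerivAt_right_branch {p : ℝ} (hp : p ≠ 0) :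
    HasDerivAt (fun q : ℝ => (q - 9) / q ^ 2 + 15 / 4) ((18 - p) / p ^ 3) p := by
  have h := (((hasDerivAt_id p).sub_const 9).div ((hasDerivAt_id p).pow 2)
    (pow_ne_zero 2 hp)).add_const (15 / 4)
  refine h.congr_deriv ?_
  simp only [id, Pi.pow_apply]
  field_simp
  ring

theorem hasDerivAt_hEx_of_lt_two {p : ℝ} (hp : 0 < p) (h : p < 2) :
    HasDerivAt hEx (2 * (p - 1)) p := by
  refine (hasDerivAt_left_branch p).congr_of_eventuallyEq ?_
  filter_upwards [Ioo_mem_nhds hp h] with q hq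
  exact hEx_of_le_two hq.1 hq.2.le

theorem hasDerivAt_hEx_of_two_lt {p : ℝ} (h : 2 < p) :
    HasDerivAt hEx ((18 - p) / p ^ 3) p := by
  refine (hasDerivAt_right_branch (by linarith)).congr_of_eventuallyEq ?_
  filter_upwards [Ioi_mem_nhds h] with q hq
  exact hEx_of_two_le (le_of_lt hq)

theorem hasDerivAt_hEx_two : HasDerivAt hEx 2 2 := by
  have hl : HasDerivWithinAt hEx 2 (Iic 2) 2 := by
    have h := ((hasDerivAt_left_branch 2).congr_deriv (g' := 2)
      (by norm_num)).hasDerivWithinAt (s := Iic 2)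
    refine h.congr_of_eventuallyEq ?_ (hEx_of_le_two two_pos le_rfl)
    filter_upwards [self_mem_nhdsWithin, mem_nhdsWithin_of_mem_nhds (Ioi_mem_nhds two_pos)]
      with q hq hq0
    exact hEx_of_le_two hq0 hq
  have hr : HasDerivWithinAt hEx 2 (Ici 2) 2 := by
    have h := ((hasDerivAt_right_branch (two_ne_zero' ℝ)).congr_deriv (g' := 2)
      (by norm_num)).hasDerivWithinAt (s := Ici 2)
    exact h.congr (fun q hq => hEx_of_two_le hq) (hEx_of_two_le le_rfl)
  have h := hl.union hr
  rwa [Iic_union_Ici, hasDerivWithinAt_univ] at h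

theorem differentiableAt_hEx {p : ℝ} (hp : 0 < p) : DifferentiableAt ℝ hEx p := by
  rcases lt_trichotomy p 2 with h | rfl | h
  · exact (hasDerivAt_hEx_of_lt_two hp h).differentiableAt
  · exact hasDerivAt_hEx_two.differentiableAt
  · exact (hasDerivAt_hEx_of_two_lt h).differentiableAt

theorem deriv_hEx_eq_zero_iff {p : ℝ} (hp : 0 < p) : deriv hEx p = 0 ↔ p = 1 ∨ p = 18 := by
  rcases lt_trichotomy p 2 with h | rfl | h
  · rw [(hasDerivAt_hEx_of_lt_two hp h).deriv]
    grind
  · rw [hasDerivAt_hEx_two.deriv]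
    norm_num
  · rw [(hasDerivAt_hEx_of_two_lt h).deriv, div_eq_zero_iff, or_iff_left (by positivity)]
    grind

theorem hEx_one : hEx 1 = 1 := by norm_num [hEx, gEx]

theorem eventually_hEx_one_lt : ∀ᶠ p in nhdsWithin 1 {(1 : ℝ)}ᶜ, hEx 1 < hEx p := by
  filter_upwards [self_mem_nhdsWithin,
    mem_nhdsWithin_of_mem_nhds (Ioo_mem_nhds zero_lt_one one_lt_two)] with p hp hp'
  rw [hEx_one, hEx_of_le_two hp'.1 hp'.2.le]
  have : 0 < (p - 1) ^ 2 := sq_pos_of_ne_zero (sub_ne_zero.mpr hp)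
  linarith

/-- `h` is differentiable on `(0, ∞)` with stationary points exactly `{1, 18}` (the
two free-boundary solutions); `h` has a strict local minimum at `p = 1`, hence for
every `x ∈ (0, 1)` the map `p ↦ V_p(x)` has a strict local minimum at `p = 1`, so the
free-boundary solution `(U₁, 1)` does not solve the optimal stopping problem even over
threshold stopping times. -/
theorem stmt_17 :
    (∀ p ∈ Ioi (0 : ℝ), DifferentiableAt ℝ hEx p) ∧
      ({p : ℝ | 0 < p ∧ deriv hEx p = 0} = {1, 18}) ∧
      (∀ᶠ p in nhdsWithin 1 {(1 : ℝ)}ᶜ, hEx 1 < hEx p) ∧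
      (∀ x ∈ Ioo (0 : ℝ) 1, ∀ᶠ p in nhdsWithin 1 {(1 : ℝ)}ᶜ, VEx 1 x < VEx p x) ∧
      ¬ (∀ x ∈ Ioi (0 : ℝ), ∀ p ∈ Ioi (0 : ℝ), VEx p x ≤ VEx 1 x) := by
  refine ⟨fun p hp => differentiableAt_hEx hp, ?_, eventually_hEx_one_lt, ?_, ?_⟩
  · ext p
    simp only [mem_ofPred_eq, mem_insert_iff, mem_singleton_iff]
    refine ⟨fun h => (deriv_hEx_eq_zero_iff h.1).mp h.2, fun h => ?_⟩
    have hp : 0 < p := by rcases h with rfl | rfl <;> norm_num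
    exact ⟨hp, (deriv_hEx_eq_zero_iff hp).mpr h⟩
  · rintro x ⟨hx0, hx1⟩
    filter_upwards [eventually_hEx_one_lt,
      mem_nhdsWithin_of_mem_nhds (Ioi_mem_nhds hx1)] with p hp hxp
    simp only [VEx, if_pos hx1, if_pos (mem_Ioi.mp hxp)]
    gcongr
  · intro h
    have := h (1 / 2) (by norm_num) 2 (by norm_num)
    norm_num [VEx, hEx, gEx] at this
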